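/- Let E be a Courant algebroid over A (algebraic form) with an orthogonal splitting E = E₁ ⊕ E₂, set ∇→_a β := pr₂(a⋄β), and define ℧(α,β) := (1/2)·pr₁(α⋄β − β⋄α) for α, β ∈ E₂. Then for all α, β ∈ E₂: (i) α⋄β = pr₂(α⋄β) + (1/2)·pr₁(D⟨α,β⟩) + ℧(α,β); and (ii) ℧ is determined by ∇→ through the relation ⟨c, ℧(α,β)⟩ = (1/2)(⟨∇→_c α, β⟩ − ⟨α, ∇→_c β⟩) for all c ∈ E₁. -/

import Mathlib

/-- A Courant algebroid over a commutative ℝ-algebra `A` (algebraic form):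
an `A`-module `E` with a symmetric nondegenerate `A`-bilinear form, an `A`-linear
anchor into the ℝ-linear derivations of `A`, an ℝ-bilinear Dorfman bracket, and
an ℝ-linear map `Dop : A → E`, satisfying the Courant algebroid axioms. -/
structure CourantAlgebroid (A : Type*) [CommRing A] [Algebra ℝ A]
    (E : Type*) [AddCommGroup E] [Module ℝ E] [Module A E] [IsScalarTower ℝ A E] where
  ip : E →ₗ[A] E →ₗ[A] A
  ip_symm : ∀ φ ψ : E, ip φ ψ = ip ψ φ
  ip_nondeg : ∀ φ : E, (∀ ψ : E, ip φ ψ = 0) → φ = 0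
  anchor : E →ₗ[A] Derivation ℝ A A
  dia : E →ₗ[ℝ] E →ₗ[ℝ] E
  Dop : A →ₗ[ℝ] E
  ip_Dop : ∀ (f : A) (φ : E), ip (Dop f) φ = anchor φ f
  jacobi : ∀ φ φ₁ φ₂ : E,
    dia φ (dia φ₁ φ₂) = dia (dia φ φ₁) φ₂ + dia φ₁ (dia φ φ₂)
  leibniz : ∀ (φ φ' : E) (f : A),
    dia φ (f • φ') = (anchor φ f) • φ' + f • dia φ φ'
  sym_part : ∀ φ : E, dia φ φ = (2⁻¹ : ℝ) • Dop (ip φ φ)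
  ad_invar : ∀ φ φ' : E, anchor φ (ip φ' φ') = 2 * ip (dia φ φ') φ'

/-- An orthogonal splitting `E = E₁ ⊕ E₂` of a Courant algebroid: `A`-submodules
forming an internal direct sum, each being the orthogonal complement of the other,
together with the corresponding projections. -/
structure OrthSplitting {A : Type*} [CommRing A] [Algebra ℝ A]
    {E : Type*} [AddCommGroup E] [Module ℝ E] [Module A E] [IsScalarTower ℝ A E]
    (C : CourantAlgebroid A E) where
  E₁ : Submodule A E
  E₂ : Submodule A E
  indep : E₁ ⊓ E₂ = ⊥
  spans : E₁ ⊔ E₂ = ⊤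
  mem_E₂_iff : ∀ ψ : E, ψ ∈ E₂ ↔ ∀ φ ∈ E₁, C.ip φ ψ = 0
  mem_E₁_iff : ∀ ψ : E, ψ ∈ E₁ ↔ ∀ φ ∈ E₂, C.ip φ ψ = 0
  pr₁ : E →ₗ[A] E
  pr₂ : E →ₗ[A] E
  pr₁_mem : ∀ x : E, pr₁ x ∈ E₁
  pr₂_mem : ∀ x : E, pr₂ x ∈ E₂
  pr_sum : ∀ x : E, pr₁ x + pr₂ x = x

theorem CourantAlgebroid.two_cancel_aux {A : Type*} [AddCommGroup A] [Module ℝ A] {x y : A}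
    (h : x + x = y + y) : x = y := by
  have h2 : (2 : ℝ) • x = (2 : ℝ) • y := by rw [two_smul, two_smul, h]
  have h3 := congrArg (fun z => (2⁻¹ : ℝ) • z) h2
  simpa [smul_smul] using h3

theorem CourantAlgebroid.dia_add_swap {A : Type*} [CommRing A] [Algebra ℝ A]
    {E : Type*} [AddCommGroup E] [Module ℝ E] [Module A E] [IsScalarTower ℝ A E]
    (C : CourantAlgebroid A E) (x y : E) :
    C.dia x y + C.dia y x = C.Dop (C.ip x y) := by
  have h := C.sym_part (x + y)
  have hx := C.sym_part x
  have hy := C.sym_part y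
  simp only [map_add, LinearMap.add_apply, smul_add] at h
  rw [hx, hy, C.ip_symm y x] at h
  have h2 : C.dia x y + C.dia y x
      = (2⁻¹ : ℝ) • C.Dop (C.ip x y) + (2⁻¹ : ℝ) • C.Dop (C.ip x y) := by
    generalize (2⁻¹ : ℝ) • C.Dop (C.ip x x) = p at h
    generalize (2⁻¹ : ℝ) • C.Dop (C.ip y y) = q at h
    generalize (2⁻¹ : ℝ) • C.Dop (C.ip x y) = r at h ⊢
    generalize C.dia x y = u at h ⊢
    generalize C.dia y x = v at h ⊢
    have e : u + v = (p + v + (u + q)) - p - q := by abel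
    rw [e, h]
    abel
  rw [h2, ← add_smul]
  norm_num

theorem CourantAlgebroid.anchor_ip {A : Type*} [CommRing A] [Algebra ℝ A]
    {E : Type*} [AddCommGroup E] [Module ℝ E] [Module A E] [IsScalarTower ℝ A E]
    (C : CourantAlgebroid A E) (φ x y : E) :
    C.anchor φ (C.ip x y) = C.ip (C.dia φ x) y + C.ip (C.dia φ y) x := by
  have h := C.ad_invar φ (x + y)
  have hx := C.ad_invar φ x
  have hy := C.ad_invar φ y
  simp only [map_add, LinearMap.add_apply] at h
  rw [hx, hy, C.ip_symm y x] at h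
  apply CourantAlgebroid.two_cancel_aux
  linear_combination h

theorem CourantAlgebroid.ip_dia_swap {A : Type*} [CommRing A] [Algebra ℝ A]
    {E : Type*} [AddCommGroup E] [Module ℝ E] [Module A E] [IsScalarTower ℝ A E]
    (C : CourantAlgebroid A E) (c x y : E) (hx : C.ip c x = 0) (hy : C.ip c y = 0) :
    C.ip c (C.dia x y) = C.ip (C.dia c x) y := by
  have h1 := C.anchor_ip x c y
  have h2 := congrArg (fun z => C.ip z y) (C.dia_add_swap c x)
  simp only [hx, map_add, LinearMap.add_apply, map_zero, LinearMap.zero_apply] at h2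
  rw [hy, map_zero, C.ip_symm (C.dia x y) c] at h1
  linear_combination -h2 - h1

/-- For `α, β ∈ E₂`, with `℧(α,β) := (1/2)·pr₁(α⋄β − β⋄α)`:
(i) `α⋄β = pr₂(α⋄β) + (1/2)·pr₁(D⟨α,β⟩) + ℧(α,β)`, and
(ii) `⟨c, ℧(α,β)⟩ = (1/2)(⟨∇→_c α, β⟩ − ⟨α, ∇→_c β⟩)` for all `c ∈ E₁`,
where `∇→_c α := pr₂(c⋄α)`. -/
theorem bracket_E₂_decomposition_and_Mho
    {A : Type*} [CommRing A] [Algebra ℝ A]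
    {E : Type*} [AddCommGroup E] [Module ℝ E] [Module A E] [IsScalarTower ℝ A E]
    (C : CourantAlgebroid A E) (S : OrthSplitting C) :
    ∀ (α β : E), α ∈ S.E₂ → β ∈ S.E₂ →
      (C.dia α β
        = S.pr₂ (C.dia α β) + (2⁻¹ : ℝ) • S.pr₁ (C.Dop (C.ip α β))
          + (2⁻¹ : ℝ) • S.pr₁ (C.dia α β - C.dia β α)) ∧
      (∀ c ∈ S.E₁,
        C.ip c ((2⁻¹ : ℝ) • S.pr₁ (C.dia α β - C.dia β α))
          = (2⁻¹ : ℝ) • (C.ip (S.pr₂ (C.dia c α)) β - C.ip α (S.pr₂ (C.dia c β)))) := by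
  intro α β hα hβ
  have hr : ∀ (r : ℝ) (x : E), r • x = (algebraMap ℝ A r) • x := fun r x =>
    (algebraMap_smul A r x).symm
  refine ⟨?_, ?_⟩
  · rw [← C.dia_add_swap α β]
    conv_lhs => rw [← S.pr_sum (C.dia α β)]
    rw [map_add, map_sub, add_assoc, ← smul_add]
    have e : S.pr₁ (C.dia α β) + S.pr₁ (C.dia β α)
        + (S.pr₁ (C.dia α β) - S.pr₁ (C.dia β α)) = (2 : ℝ) • S.pr₁ (C.dia α β) := by
      rw [two_smul]; abel
    rw [e, smul_smul, inv_mul_cancel₀ (two_ne_zero), one_smul, add_comm]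
  · intro c hc
    have h1 : ∀ x : E, C.ip c (S.pr₁ x) = C.ip c x := fun x => by
      conv_rhs => rw [← S.pr_sum x]
      rw [map_add, (S.mem_E₂_iff _).1 (S.pr₂_mem x) c hc, add_zero]
    have h2 : ∀ x γ : E, γ ∈ S.E₂ → C.ip (S.pr₂ x) γ = C.ip x γ := fun x γ hγ => by
      conv_rhs => rw [← S.pr_sum x]
      rw [map_add, LinearMap.add_apply, (S.mem_E₂_iff _).1 hγ _ (S.pr₁_mem x), zero_add]
    have hcα := (S.mem_E₂_iff α).1 hα c hc
    have hcβ := (S.mem_E₂_iff β).1 hβ c hc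
    rw [hr, map_smul, algebraMap_smul, h1, map_sub, C.ip_dia_swap c α β hcα hcβ,
      C.ip_dia_swap c β α hcβ hcα, C.ip_symm α, h2 _ _ hβ, h2 _ _ hα]
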